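/- Suppose the vector p ∈ ℝ^{(m+n)+mn}, with coordinates p_{A_i}, p_{B_j}, p_{A_iB_j}, is realized by a finite-dimensional quantum realization (d_A, d_B, ρ, A_1,…,A_m, B_1,…,B_n) via p_{A_i} = tr(ρ ((I − A_i)/2 ⊗ I)), p_{B_j} = tr(ρ (I ⊗ (I − B_j)/2)) and p_{A_iB_j} = tr(ρ ((I − A_i)/2 ⊗ (I − B_j)/2)). Then the vector p' defined by p'_{A_i} = p'_{B_j} = 1/2 and p'_{A_iB_j} = p_{A_iB_j} − (1/2)p_{A_i} − (1/2)p_{B_j} + 1/2 is also realized by some finite-dimensional quantum realization in the same way. -/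

import Mathlib

open Finset Matrix Kronecker ComplexOrder

/-- `QRealizes m n p` states that the vector `p = (pA, pB, pAB)` is realized by
a finite-dimensional quantum realization `(d_A, d_B, ρ, A_i, B_j)` via
`pA i = tr (ρ ((I − A_i)/2 ⊗ I))`, `pB j = tr (ρ (I ⊗ (I − B_j)/2))` and
`pAB i j = tr (ρ ((I − A_i)/2 ⊗ (I − B_j)/2))`. -/
def QRealizes (m n : ℕ)
    (p : (Fin m → ℝ) × (Fin n → ℝ) × (Fin m → Fin n → ℝ)) : Prop :=
  ∃ (dA dB : ℕ), 0 < dA ∧ 0 < dB ∧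
    ∃ (ρ : Matrix (Fin dA × Fin dB) (Fin dA × Fin dB) ℂ)
      (A : Fin m → Matrix (Fin dA) (Fin dA) ℂ)
      (B : Fin n → Matrix (Fin dB) (Fin dB) ℂ),
      ρ.PosSemidef ∧ ρ.trace = 1 ∧
      (∀ i, (A i).IsHermitian) ∧ (∀ j, (B j).IsHermitian) ∧
      (∀ i, (1 - A i).PosSemidef) ∧ (∀ i, (1 + A i).PosSemidef) ∧
      (∀ j, (1 - B j).PosSemidef) ∧ (∀ j, (1 + B j).PosSemidef) ∧
      (∀ i, (p.1 i : ℂ) =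
        (ρ * (((2 : ℂ)⁻¹ • (1 - A i)) ⊗ₖ (1 : Matrix (Fin dB) (Fin dB) ℂ))).trace) ∧
      (∀ j, (p.2.1 j : ℂ) =
        (ρ * ((1 : Matrix (Fin dA) (Fin dA) ℂ) ⊗ₖ ((2 : ℂ)⁻¹ • (1 - B j)))).trace) ∧
      (∀ i j, (p.2.2 i j : ℂ) =
        (ρ * (((2 : ℂ)⁻¹ • (1 - A i)) ⊗ₖ ((2 : ℂ)⁻¹ • (1 - B j)))).trace)

/-- The space `ℂ^(d+d)` is an orthogonal direct sum of two isometric copies of `ℂ^d`. -/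
lemma exists_isometry_pair (d : ℕ) :
    ∃ E F : Matrix (Fin (d + d)) (Fin d) ℂ,
      Eᴴ * E = 1 ∧ Fᴴ * F = 1 ∧ Eᴴ * F = 0 ∧ E * Eᴴ + F * Fᴴ = 1 := by
  have hne (x y : Fin d) : Fin.castAdd d x ≠ Fin.natAdd d y := by
    simp only [ne_eq, Fin.ext_iff, Fin.val_castAdd, Fin.val_natAdd]; omega
  refine ⟨(1 : Matrix (Fin (d + d)) (Fin (d + d)) ℂ).submatrix id (Fin.castAdd d),
    (1 : Matrix (Fin (d + d)) (Fin (d + d)) ℂ).submatrix id (Fin.natAdd d), ?_, ?_, ?_, ?_⟩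
  case refine_4 =>
    ext i j
    induction i using Fin.addCases <;> induction j using Fin.addCases <;>
      simp [Matrix.mul_apply, Matrix.one_apply, hne, (hne _ _).symm, eq_comm, -Fin.natAdd_eq_addNat]
  all_goals
    ext i j
    simp [Matrix.mul_apply, Matrix.one_apply, (hne _ _).symm, eq_comm, -Fin.natAdd_eq_addNat]

/-- A contraction `A` extends to the doubled space as `A ⊕ (-A)`. -/
lemma exists_sign_dilation {d k : ℕ} (A : Fin k → Matrix (Fin d) (Fin d) ℂ)
    (hA : ∀ i, (A i).IsHermitian) (hsub : ∀ i, (1 - A i).PosSemidef)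
    (hadd : ∀ i, (1 + A i).PosSemidef) :
    ∃ (E F : Matrix (Fin (d + d)) (Fin d) ℂ)
      (A' : Fin k → Matrix (Fin (d + d)) (Fin (d + d)) ℂ),
      Eᴴ * E = 1 ∧ Fᴴ * F = 1 ∧
      (∀ i, (A' i).IsHermitian) ∧ (∀ i, (1 - A' i).PosSemidef) ∧
      (∀ i, (1 + A' i).PosSemidef) ∧
      (∀ i, Eᴴ * A' i * E = A i) ∧ (∀ i, Fᴴ * A' i * F = -A i) := by
  obtain ⟨E, F, hE, hF, hEF, hsum⟩ := exists_isometry_pair d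
  refine ⟨E, F, fun i => E * A i * Eᴴ - F * A i * Fᴴ, hE, hF, fun i => ?_, fun i => ?_,
    fun i => ?_, fun i => ?_, fun i => ?_⟩
  · exact (isHermitian_mul_mul_conjTranspose E (hA i)).sub
      (isHermitian_mul_mul_conjTranspose F (hA i))
  · have h : 1 - (E * A i * Eᴴ - F * A i * Fᴴ) = E * (1 - A i) * Eᴴ + F * (1 + A i) * Fᴴ := by
      rw [← hsum]
      simp only [Matrix.mul_add, Matrix.add_mul, Matrix.mul_sub, Matrix.sub_mul, Matrix.mul_one]
      abel
    rw [h]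
    exact ((hsub i).mul_mul_conjTranspose_same E).add ((hadd i).mul_mul_conjTranspose_same F)
  · have h : 1 + (E * A i * Eᴴ - F * A i * Fᴴ) = E * (1 + A i) * Eᴴ + F * (1 - A i) * Fᴴ := by
      rw [← hsum]
      simp only [Matrix.mul_add, Matrix.add_mul, Matrix.mul_sub, Matrix.sub_mul, Matrix.mul_one]
      abel
    rw [h]
    exact ((hadd i).mul_mul_conjTranspose_same E).add ((hsub i).mul_mul_conjTranspose_same F)
  · have h : Eᴴ * (E * A i * Eᴴ - F * A i * Fᴴ) * E =
        (Eᴴ * E) * A i * (Eᴴ * E) - (Eᴴ * F) * A i * (Fᴴ * E) := by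
      simp only [Matrix.mul_sub, Matrix.sub_mul, Matrix.mul_assoc]
    rw [h, hE, hEF]; simp
  · have h : Fᴴ * (E * A i * Eᴴ - F * A i * Fᴴ) * F =
        (Fᴴ * E) * A i * (Eᴴ * F) - (Fᴴ * F) * A i * (Fᴴ * F) := by
      simp only [Matrix.mul_sub, Matrix.sub_mul, Matrix.mul_assoc]
    rw [h, hF, hEF]; simp

lemma trace_kronecker_conj_mul {a b c d : Type*} [Fintype a] [Fintype b] [Fintype c] [Fintype d]
    (ρ : Matrix (a × b) (a × b) ℂ) (E : Matrix c a ℂ) (G : Matrix d b ℂ)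
    (X : Matrix c c ℂ) (Y : Matrix d d ℂ) :
    ((E ⊗ₖ G) * ρ * (E ⊗ₖ G)ᴴ * (X ⊗ₖ Y)).trace =
      (ρ * ((Eᴴ * X * E) ⊗ₖ (Gᴴ * Y * G))).trace := by
  rw [Matrix.mul_kronecker_mul, Matrix.mul_kronecker_mul, ← Matrix.conjTranspose_kronecker,
    Matrix.mul_assoc, Matrix.mul_assoc, Matrix.trace_mul_comm, Matrix.mul_assoc]

lemma neg_kronecker_eq {a b c d : Type*} (X : Matrix a b ℂ) (Y : Matrix c d ℂ) :
    (-X) ⊗ₖ Y = -(X ⊗ₖ Y) := by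
  ext; simp

lemma kronecker_neg_eq {a b c d : Type*} (X : Matrix a b ℂ) (Y : Matrix c d ℂ) :
    X ⊗ₖ (-Y) = -(X ⊗ₖ Y) := by
  ext; simp

/-- If `p` is quantum-realizable, then so is the vector `p'` with
`p'_{A_i} = p'_{B_j} = 1/2` and
`p'_{A_iB_j} = p_{A_iB_j} − p_{A_i}/2 − p_{B_j}/2 + 1/2`. -/
theorem qRealizes_shift (m n : ℕ)
    (p : (Fin m → ℝ) × (Fin n → ℝ) × (Fin m → Fin n → ℝ))
    (hp : QRealizes m n p) :
    QRealizes m n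
      (fun _ => 1 / 2, fun _ => 1 / 2,
       fun i j => p.2.2 i j - (1 / 2) * p.1 i - (1 / 2) * p.2.1 j + 1 / 2) := by
  obtain ⟨dA, dB, hdA, hdB, ρ, A, B, hρ, htr, hA, hB, hAs, hAa, hBs, hBa, hpA, hpB, hpAB⟩ := hp
  obtain ⟨E, F, A', hE, hF, hA', hAs', hAa', hEA, hFA⟩ := exists_sign_dilation A hA hAs hAa
  obtain ⟨G, H, B', hG, hH, hB', hBs', hBa', hGB, hHB⟩ := exists_sign_dilation B hB hBs hBa
  set σ : Matrix (Fin (dA + dA) × Fin (dB + dB)) (Fin (dA + dA) × Fin (dB + dB)) ℂ :=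
    (2 : ℂ)⁻¹ • ((E ⊗ₖ G) * ρ * (E ⊗ₖ G)ᴴ + (F ⊗ₖ H) * ρ * (F ⊗ₖ H)ᴴ) with hσ
  have trace_σ (X : Matrix (Fin (dA + dA)) (Fin (dA + dA)) ℂ)
      (Y : Matrix (Fin (dB + dB)) (Fin (dB + dB)) ℂ) :
      (σ * (X ⊗ₖ Y)).trace = (2 : ℂ)⁻¹ * ((ρ * ((Eᴴ * X * E) ⊗ₖ (Gᴴ * Y * G))).trace +
        (ρ * ((Fᴴ * X * F) ⊗ₖ (Hᴴ * Y * H))).trace) := by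
    rw [hσ, Matrix.smul_mul, Matrix.trace_smul, Matrix.add_mul, Matrix.trace_add,
      trace_kronecker_conj_mul, trace_kronecker_conj_mul, smul_eq_mul]
  have htr' : (ρ * ((1 : Matrix (Fin dA) (Fin dA) ℂ) ⊗ₖ
      (1 : Matrix (Fin dB) (Fin dB) ℂ))).trace = 1 := by
    rw [Matrix.one_kronecker_one, Matrix.mul_one, htr]
  refine ⟨dA + dA, dB + dB, by omega, by omega, σ, A', B', ?_, ?_, hA', hB', hAs', hAa', hBs',
    hBa', fun i => ?_, fun j => ?_, fun i j => ?_⟩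
  · exact ((hρ.mul_mul_conjTranspose_same _).add (hρ.mul_mul_conjTranspose_same _)).smul
      (by positivity)
  · have h := trace_σ 1 1
    simp only [Matrix.one_kronecker_one, Matrix.mul_one, hE, hF, hG, hH, htr] at h
    rw [h]; norm_num
  · simp only [trace_σ, Matrix.mul_smul, Matrix.mul_one, hE, hF, hG, hH, hEA, hFA,
      Matrix.smul_kronecker, sub_eq_add_neg,
      Matrix.add_kronecker, Matrix.mul_add, Matrix.trace_add, Matrix.trace_smul,
      neg_kronecker_eq, Matrix.mul_neg, Matrix.trace_neg, htr', smul_eq_mul]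
    push_cast; ring
  · simp only [trace_σ, Matrix.mul_smul, Matrix.mul_one, hE, hF, hG, hH, hGB, hHB,
      Matrix.kronecker_smul, sub_eq_add_neg,
      Matrix.kronecker_add, Matrix.mul_add, Matrix.trace_add, Matrix.trace_smul,
      kronecker_neg_eq, Matrix.mul_neg, Matrix.trace_neg, htr', smul_eq_mul]
    push_cast; ring
  · push_cast
    rw [hpAB, hpA, hpB]
    simp only [trace_σ, Matrix.mul_smul, Matrix.mul_one, hE, hF, hG, hH, hEA, hFA, hGB, hHB,
      Matrix.smul_kronecker,
      Matrix.kronecker_smul, sub_eq_add_neg, Matrix.add_kronecker, Matrix.kronecker_add,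
      Matrix.mul_add, Matrix.trace_add, Matrix.trace_smul, neg_neg, neg_kronecker_eq,
      kronecker_neg_eq, Matrix.mul_neg, Matrix.trace_neg, htr', smul_eq_mul]
    ring
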